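/- Let A = y_1 y_2, B = -(h-corrected middle coefficient) and C = x_1 x_2 + h x_1 y_2 + 2h y_1 x_2 + 2h^2 y_1 y_2 be the coefficients of the quadratic form (01)(02) = x^2 A + x y B + y^2 C. Then the generator x = x_0 and y = y_0 satisfy A x = x A - 2h y A, A y = y A, B x = x B + h x A + h^2 y A, B y = y B - h y A, C x = x C + 2h y C + 2h x B + 4h^2 y B, and C y = y C - 2h y B + 2h^2 y A. -/

import Mathlib

/-- Commutation relations of the coefficients `A, B, C` of the quadratic form
`(01)(02) = x² A + 2 x y B + y² C` with the generators `x = x₀`, `y = y₀`. -/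
theorem quadratic_form_generator_relations {R : Type*} [Ring R] [Algebra ℂ R]
    (h : ℂ) (x y : Fin 3 → R)
    (rel_diag : ∀ i, x i * y i = y i * x i + h • (y i * y i))
    (rel_xy : ∀ i j, i < j → x j * y i = y i * x j + h • (y i * y j))
    (rel_yx : ∀ i j, i < j → y j * x i = x i * y j - h • (y i * y j))
    (rel_yy : ∀ i j, i < j → y j * y i = y i * y j)
    (rel_xx : ∀ i j, i < j →
      x j * x i = x i * x j - h • (x i * y j) + h • (y i * x j) + (h * h) • (y i * y j))
    (A B C : R)
    (hA : A = y 1 * y 2)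
    (hB : B = -((1 / 2 : ℂ) • (x 1 * y 2 + y 1 * x 2)) - h • (y 1 * y 2))
    (hC : C = x 1 * x 2 + h • (x 1 * y 2) + (2 * h) • (y 1 * x 2) + (2 * h ^ 2) • (y 1 * y 2)) :
    A * x 0 = x 0 * A - (2 * h) • (y 0 * A) ∧
    A * y 0 = y 0 * A ∧
    B * x 0 = x 0 * B + h • (x 0 * A) + (h ^ 2) • (y 0 * A) ∧
    B * y 0 = y 0 * B - h • (y 0 * A) ∧
    C * x 0 = x 0 * C + (2 * h) • (y 0 * C) + (2 * h) • (x 0 * B) + (4 * h ^ 2) • (y 0 * B) ∧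
    C * y 0 = y 0 * C - (2 * h) • (y 0 * B) + (2 * h ^ 2) • (y 0 * A) := by
  have hxy (j : Fin 3) (hj : 0 < j) (z : R) :
      x j * (y 0 * z) = y 0 * (x j * z) + h • (y 0 * (y j * z)) := by
    rw [← mul_assoc, rel_xy 0 j hj]
    simp only [add_mul, smul_mul_assoc, mul_assoc]
  have hyx (j : Fin 3) (hj : 0 < j) (z : R) :
      y j * (x 0 * z) = x 0 * (y j * z) - h • (y 0 * (y j * z)) := by
    rw [← mul_assoc, rel_yx 0 j hj]
    simp only [sub_mul, smul_mul_assoc, mul_assoc]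
  have hyy (j : Fin 3) (hj : 0 < j) (z : R) : y j * (y 0 * z) = y 0 * (y j * z) := by
    rw [← mul_assoc, rel_yy 0 j hj, mul_assoc]
  have hxx (j : Fin 3) (hj : 0 < j) (z : R) :
      x j * (x 0 * z) = x 0 * (x j * z) - h • (x 0 * (y j * z)) + h • (y 0 * (x j * z)) +
        (h * h) • (y 0 * (y j * z)) := by
    rw [← mul_assoc, rel_xx 0 j hj]
    simp only [add_mul, sub_mul, smul_mul_assoc, mul_assoc]
  have h₁ : (0 : Fin 3) < 1 := by decide
  have h₂ : (0 : Fin 3) < 2 := by decide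
  subst hA hB hC
  refine ⟨?_, ?_, ?_, ?_, ?_, ?_⟩ <;>
    simp only [mul_assoc, add_mul, sub_mul, neg_mul, mul_add, mul_sub, mul_neg, smul_mul_assoc,
      mul_smul_comm, rel_xy 0 _ h₂, rel_yx 0 _ h₂, rel_yy 0 _ h₂, rel_xx 0 _ h₂,
      hxy _ h₁, hyx _ h₁, hyy _ h₁, hxx _ h₁] <;>
    module
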